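/- Let M > 0, a ≥ 3/2, and b > 0 with bM ≤ 1. Let Φ : ℝ² → ℝ² be a continuous map with ‖Φ(z)‖ ≤ M for all z ∈ ℝ², and define f : ℝ² → ℝ² by f(x,y) = (1 − a x², 0) + b·Φ(x,y). Then the nonwandering set Ω of f is contained in the rectangle [−2, 2] × [−bM, bM]; in particular Ω is a bounded set. -/

import Mathlib

/-- The nonwandering set of a map `f : ℝ² → ℝ²`: points `z` such that every
open neighborhood `U` of `z` satisfies `f^[n] U ∩ U ≠ ∅` for some `n ≥ 1`. -/
def nonwanderingSet (f : ℝ × ℝ → ℝ × ℝ) : Set (ℝ × ℝ) :=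
  {z | ∀ U : Set (ℝ × ℝ), IsOpen U → z ∈ U →
    ∃ n : ℕ, 1 ≤ n ∧ (f^[n] '' U ∩ U).Nonempty}

/-- For the Hénon-like map `f(x,y) = (1 − a x², 0) + b Φ(x,y)`
with `‖Φ‖ ≤ M`, `a ≥ 3/2`, `0 < b`, `bM ≤ 1`, the nonwandering set is
contained in the rectangle `[−2,2] × [−bM, bM]`; in particular it is bounded. -/
theorem stmt7 (M a b : ℝ) (hM : 0 < M) (ha : 3 / 2 ≤ a) (hb : 0 < b)
    (hbM : b * M ≤ 1)
    (Φ : ℝ × ℝ → ℝ × ℝ) (hΦc : Continuous Φ) (hΦ : ∀ z, ‖Φ z‖ ≤ M)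
    (f : ℝ × ℝ → ℝ × ℝ)
    (hf : ∀ x y : ℝ, f (x, y) = (1 - a * x ^ 2, 0) + b • Φ (x, y)) :
    nonwanderingSet f ⊆ Set.Icc (-2 : ℝ) 2 ×ˢ Set.Icc (-(b * M)) (b * M) ∧
      Bornology.IsBounded (nonwanderingSet f) := by
  have hbd : ∀ z, |b * (Φ z).1| ≤ b * M ∧ |b * (Φ z).2| ≤ b * M := by
    intro z
    rw [abs_mul, abs_mul, abs_of_pos hb]
    have h1 : |(Φ z).1| ≤ M := (norm_fst_le (Φ z)).trans (hΦ z)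
    have h2 : |(Φ z).2| ≤ M := (norm_snd_le (Φ z)).trans (hΦ z)
    exact ⟨mul_le_mul_of_nonneg_left h1 hb.le, mul_le_mul_of_nonneg_left h2 hb.le⟩
  have e1 : ∀ z, (f z).1 ≤ 2 - 3 / 2 * z.1 ^ 2 := by
    rintro ⟨x, y⟩
    have h := (abs_le.1 (hbd (x, y)).1).2
    have h3 : 3 / 2 * x ^ 2 ≤ a * x ^ 2 := mul_le_mul_of_nonneg_right ha (sq_nonneg x)
    rw [hf]
    simp only [Prod.fst_add, Prod.smul_fst, smul_eq_mul]
    linarith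
  have e2 : ∀ z, |(f z).2| ≤ b * M := by
    rintro ⟨x, y⟩
    rw [hf]
    simpa using (hbd (x, y)).2
  have esc : ∀ n : ℕ, ∀ z : ℝ × ℝ, z.1 ≤ -2 → (f^[n] z).1 ≤ z.1 - 2 * n := by
    intro n
    induction n with
    | zero => intro z _; simp
    | succ k ih =>
      intro z hz
      have h := e1 z
      have h2 : (f z).1 ≤ z.1 - 2 := by nlinarith
      have h3 := ih (f z) (by linarith)
      rw [Function.iterate_succ_apply]
      push_cast
      linarith
  have key : nonwanderingSet f ⊆ Set.Icc (-2 : ℝ) 2 ×ˢ Set.Icc (-(b * M)) (b * M) := by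
    intro z hz
    refine ⟨⟨?_, ?_⟩, abs_le.1 ?_⟩
    · by_contra! hlt
      obtain ⟨n, hn, _, ⟨w, hw, rfl⟩, hv⟩ := hz
        ({p | p.1 < -2} ∩ ({p | p.1 < z.1 + 1 / 2} ∩ {p | z.1 - 1 / 2 < p.1}))
        ((isOpen_lt (by fun_prop) (by fun_prop)).inter
          ((isOpen_lt (by fun_prop) (by fun_prop)).inter
            (isOpen_lt (by fun_prop) (by fun_prop))))
        ⟨hlt, show z.1 < z.1 + 1 / 2 by linarith, show z.1 - 1 / 2 < z.1 by linarith⟩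
      have h := esc n w (le_of_lt hw.1)
      have hn' : (1 : ℝ) ≤ n := by exact_mod_cast hn
      have h1 : w.1 < z.1 + 1 / 2 := hw.2.1
      have h2 : z.1 - 1 / 2 < (f^[n] w).1 := hv.2.2
      linarith
    · by_contra! hlt
      obtain ⟨n, hn, _, ⟨w, hw, rfl⟩, hv⟩ := hz {p | 2 < p.1}
        (isOpen_lt (by fun_prop) (by fun_prop)) hlt
      obtain ⟨k, rfl⟩ : ∃ k, n = k + 1 := ⟨n - 1, by omega⟩
      rw [Function.iterate_succ_apply'] at hv
      have h := e1 (f^[k] w)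
      have h1 : 2 < (f (f^[k] w)).1 := hv
      nlinarith [sq_nonneg (f^[k] w).1]
    · by_contra! hlt
      obtain ⟨n, hn, _, ⟨w, hw, rfl⟩, hv⟩ := hz {p | b * M < |p.2|}
        (isOpen_lt (by fun_prop) (by fun_prop)) hlt
      obtain ⟨k, rfl⟩ : ∃ k, n = k + 1 := ⟨n - 1, by omega⟩
      rw [Function.iterate_succ_apply'] at hv
      exact absurd (e2 (f^[k] w)) (not_le.2 hv)
  exact ⟨key, ((Metric.isBounded_Icc _ _).prod (Metric.isBounded_Icc _ _)).subset key⟩
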